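/- Let c^U(n) denote the number of compositions (c_1,…,c_t) of n such that c_{2i-1} = 1 for every odd index 2i−1 ≤ t and c_{2i} is even for every even index 2i ≤ t. Then c^U(1) = 1, c^U(2) = 0, c^U(3) = 1, and c^U(n) = c^U(n−2) + c^U(n−3) for every n ≥ 4. -/

import Mathlib

/-- A composition of `n`: a list of positive integers summing to `n`. -/
def IsComposition (n : ℕ) (l : List ℕ) : Prop :=
  (∀ x ∈ l, 0 < x) ∧ l.sum = n

/-- The compositions of `n` with parts `1` in odd positions and even parts in even positions
(positions being 1-based). -/
def oneEvenCompositions (n : ℕ) : Set (List ℕ) :=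
  {l | IsComposition n l ∧
    (∀ i : ℕ, 2 * i < l.length → l.getD (2 * i) 0 = 1) ∧
    (∀ i : ℕ, 2 * i + 1 < l.length → Even (l.getD (2 * i + 1) 0))}

namespace oneEvenCompositions

theorem nil_mem_iff {n : ℕ} : [] ∈ oneEvenCompositions n ↔ n = 0 := by
  simp [oneEvenCompositions, IsComposition, eq_comm]

theorem singleton_mem_iff {n a : ℕ} : [a] ∈ oneEvenCompositions n ↔ a = 1 ∧ n = 1 := by
  constructor
  · rintro ⟨⟨-, hs⟩, ho, -⟩
    have := ho 0
    simp_all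
  · rintro ⟨rfl, rfl⟩
    refine ⟨by simp [IsComposition], fun i hi => ?_, fun i hi => ?_⟩
    · obtain rfl : i = 0 := by simp at hi; omega
      rfl
    · simp at hi

theorem cons_cons_mem_iff {n a b : ℕ} {l : List ℕ} :
    a :: b :: l ∈ oneEvenCompositions n ↔
      a = 1 ∧ 0 < b ∧ Even b ∧ ∃ m, n = m + b + 1 ∧ l ∈ oneEvenCompositions m := by
  constructor
  · rintro ⟨⟨hp, hs⟩, ho, he⟩
    have ha := ho 0
    have hb := he 0
    simp only [List.mem_cons, forall_eq_or_imp, List.sum_cons] at hp hs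
    simp only [List.length_cons] at ho he
    refine ⟨by simpa using ha, hp.2.1, by simpa using hb, l.sum, ?_, ⟨hp.2.2, rfl⟩, ?_, ?_⟩
    · simp at ha
      omega
    · intro i hi
      simpa [mul_add] using ho (i + 1) (by omega)
    · intro i hi
      simpa [mul_add, add_right_comm] using he (i + 1) (by omega)
  · rintro ⟨rfl, hb, hb', m, rfl, ⟨hp, rfl⟩, ho, he⟩
    refine ⟨⟨by simpa using ⟨hb, hp⟩, by simp; omega⟩, ?_, ?_⟩
    · rintro (_ | i) hi
      · rfl
      · simpa [mul_add] using ho i (by simp at hi; omega)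
    · rintro (_ | i) hi
      · simpa using hb'
      · simpa [mul_add, add_right_comm] using he i (by simp at hi; omega)

protected theorem finite (n : ℕ) : (oneEvenCompositions n).Finite :=
  (Set.finite_range (Composition.blocks (n := n))).subset
    fun l hl => ⟨⟨l, hl.1.1 _, hl.1.2⟩, rfl⟩

theorem eq_one : oneEvenCompositions 1 = {[1]} := by
  ext l
  match l with
  | [] => simp [nil_mem_iff]
  | [a] => simp [singleton_mem_iff]
  | a :: b :: l =>
    simp only [cons_cons_mem_iff, Set.mem_singleton_iff]
    grind

theorem eq_two : oneEvenCompositions 2 = ∅ := by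
  ext l
  match l with
  | [] => simp [nil_mem_iff]
  | [a] => simp [singleton_mem_iff]
  | a :: b :: l =>
    simp only [cons_cons_mem_iff, Set.mem_empty_iff_false]
    grind

/-- Increase the second entry of a list by `2`. -/
def addTwoSecond : List ℕ → List ℕ
  | a :: b :: l => a :: (b + 2) :: l
  | l => l

theorem addTwoSecond_injective : Function.Injective addTwoSecond := by
  intro l l' h
  match l, l' with
  | [], [] => rfl
  | [], [_] | [], _ :: _ :: _ | [_], [] | [_], _ :: _ :: _ | _ :: _ :: _, []
  | _ :: _ :: _, [_] => simp [addTwoSecond] at h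
  | [_], [_] => exact h
  | _ :: _ :: _, _ :: _ :: _ => simpa [addTwoSecond] using h

theorem add_three_eq (n : ℕ) (hn : n ≠ 0) :
    oneEvenCompositions (n + 3) =
      addTwoSecond '' oneEvenCompositions (n + 1) ∪
        (fun l => 1 :: 2 :: l) '' oneEvenCompositions n := by
  ext l
  constructor
  · intro hl
    match l with
    | [] => simp [nil_mem_iff] at hl
    | [a] => simp [singleton_mem_iff] at hl
    | a :: b :: l =>
      obtain ⟨rfl, hb, ⟨k, rfl⟩, m, hm, hl'⟩ := cons_cons_mem_iff.1 hl
      obtain rfl | ⟨j, rfl⟩ : k = 1 ∨ ∃ j, k = j + 2 := by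
        rcases k with _ | _ | k
        · omega
        · exact .inl rfl
        · exact .inr ⟨k, rfl⟩
      · obtain rfl : n = m := by omega
        exact .inr ⟨l, hl', rfl⟩
      · refine .inl ⟨1 :: (j + 1 + (j + 1)) :: l, cons_cons_mem_iff.2
          ⟨rfl, by omega, ⟨_, rfl⟩, m, by omega, hl'⟩, ?_⟩
        simp only [addTwoSecond, List.cons.injEq, and_true, true_and]
        omega
  · rintro (⟨l, hl, rfl⟩ | ⟨l, hl, rfl⟩)
    · match l with
      | [] => simp [nil_mem_iff] at hl
      | [a] => simp [singleton_mem_iff, hn] at hl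
      | a :: b :: l =>
        obtain ⟨rfl, hb, hb', m, hm, hl⟩ := cons_cons_mem_iff.1 hl
        exact cons_cons_mem_iff.2 ⟨rfl, by omega, hb'.add even_two, m, by omega, hl⟩
    · exact cons_cons_mem_iff.2 ⟨rfl, two_pos, even_two, n, rfl, hl⟩

theorem eq_three : oneEvenCompositions 3 = {[1, 2]} := by
  ext l
  match l with
  | [] => simp [nil_mem_iff]
  | [a] => simp [singleton_mem_iff]
  | [a, b] =>
    simp only [cons_cons_mem_iff, nil_mem_iff, Set.mem_singleton_iff]
    grind
  | [a, b, c] =>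
    simp only [cons_cons_mem_iff, singleton_mem_iff, Set.mem_singleton_iff]
    grind
  | a :: b :: c :: d :: l =>
    simp only [cons_cons_mem_iff, Set.mem_singleton_iff]
    grind

theorem ncard_add_three (n : ℕ) (hn : n ≠ 0) :
    (oneEvenCompositions (n + 3)).ncard =
      (oneEvenCompositions (n + 1)).ncard + (oneEvenCompositions n).ncard := by
  rw [add_three_eq n hn, Set.ncard_union_eq ?_ ((oneEvenCompositions.finite _).image _)
    ((oneEvenCompositions.finite _).image _), Set.ncard_image_of_injective _ addTwoSecond_injective,
    Set.ncard_image_of_injective _ fun _ _ h => by simpa using h]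
  rw [Set.disjoint_left]
  rintro _ ⟨l, hl, rfl⟩ ⟨l', -, h⟩
  match l with
  | [] | [_] => simp [addTwoSecond] at h
  | a :: b :: l =>
    have := (cons_cons_mem_iff.1 hl).2.1
    simp only [addTwoSecond, List.cons.injEq] at h
    omega

end oneEvenCompositions

/-- `cU n` is the number of compositions of `n` whose parts in odd positions
(1-based) all equal `1` and whose parts in even positions (1-based) are all
even.  It satisfies the Padovan recurrence. -/
theorem cU_recurrence (cU : ℕ → ℕ)
    (hcU : ∀ n : ℕ, cU n = Nat.card {l : List ℕ // IsComposition n l ∧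
      (∀ i : ℕ, 2 * i < l.length → l.getD (2 * i) 0 = 1) ∧
      (∀ i : ℕ, 2 * i + 1 < l.length → Even (l.getD (2 * i + 1) 0))}) :
    cU 1 = 1 ∧ cU 2 = 0 ∧ cU 3 = 1 ∧
      ∀ n : ℕ, 4 ≤ n → cU n = cU (n - 2) + cU (n - 3) := by
  have h (n : ℕ) : cU n = (oneEvenCompositions n).ncard := hcU n
  simp only [h]
  refine ⟨by simp [oneEvenCompositions.eq_one], by simp [oneEvenCompositions.eq_two],
    by simp [oneEvenCompositions.eq_three], fun n hn => ?_⟩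
  obtain ⟨m, rfl⟩ := Nat.exists_eq_add_of_le' (show 3 ≤ n by omega)
  exact oneEvenCompositions.ncard_add_three m (by omega)
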